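/- arXiv:1304.4267 — 2 statements merged into one kernel-verified Lean document; each statement's English description precedes it below -/
import Mathlib

section
/- Let M be a finite structure with one binary relation symbol E. Then M satisfies the Inclusion Logic sentence ∃x∃y(y ⊆ x ∧ Exy) if and only if E^M contains a cycle, i.e., there exist n ≥ 1 and elements a₀,…,a_{n−1} ∈ dom(M) such that (a_i, a_{i+1}) ∈ E^M for all i < n−1 and (a_{n−1}, a₀) ∈ E^M. -/
open FirstOrder Language Set

namespace TeamSem

/-- The set of variables occurring in a term. -/
def tvars {L : Language} : L.Term ℕ → Set ℕ
  | Term.var v => {v}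
  | Term.func _ ts => ⋃ i, tvars (ts i)

/-- Formulas of Inclusion Logic FO(⊆) in negation normal form, over the signature `L`,
with variables from `ℕ`. -/
inductive IncForm (L : Language) where
  | rel {n : ℕ} (R : L.Relations n) (ts : Fin n → L.Term ℕ)
  | nrel {n : ℕ} (R : L.Relations n) (ts : Fin n → L.Term ℕ)
  | eq (t u : L.Term ℕ)
  | neq (t u : L.Term ℕ)
  | incl {k : ℕ} (ts us : Fin k → L.Term ℕ)
  | and (φ ψ : IncForm L)
  | or (φ ψ : IncForm L)
  | ex (v : ℕ) (φ : IncForm L)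
  | all (v : ℕ) (φ : IncForm L)

variable {L : Language}

/-- The supplemented team `X[H/v]`. -/
def suppTeam {M : Type*} (X : Set (ℕ → M)) (H : (ℕ → M) → Set M) (v : ℕ) : Set (ℕ → M) :=
  {t | ∃ s ∈ X, ∃ m ∈ H s, t = Function.update s v m}

/-- The duplicated team `X[M/v]`. -/
def dupTeam (M : Type*) (X : Set (ℕ → M)) (v : ℕ) : Set (ℕ → M) :=
  {t | ∃ s ∈ X, ∃ m : M, t = Function.update s v m}

/-- Lax team semantics for Inclusion Logic: `teamSat M φ X` says `M ⊨_X φ`. -/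
def teamSat (M : Type*) [L.Structure M] : IncForm L → Set (ℕ → M) → Prop
  | .rel R ts, X => ∀ s ∈ X, Structure.RelMap R fun i => (ts i).realize s
  | .nrel R ts, X => ∀ s ∈ X, ¬ Structure.RelMap R fun i => (ts i).realize s
  | .eq t u, X => ∀ s ∈ X, t.realize s = u.realize s
  | .neq t u, X => ∀ s ∈ X, t.realize s ≠ u.realize s
  | .incl ts us, X => ∀ s ∈ X, ∃ s' ∈ X, ∀ i, (ts i).realize s = (us i).realize s'
  | .and φ ψ, X => teamSat M φ X ∧ teamSat M ψ X
  | .or φ ψ, X => ∃ Y Z, X = Y ∪ Z ∧ teamSat M φ Y ∧ teamSat M ψ Z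
  | .ex v φ, X => ∃ H : (ℕ → M) → Set M, (∀ s ∈ X, (H s).Nonempty) ∧
      teamSat M φ (suppTeam X H v)
  | .all v φ, X => teamSat M φ (dupTeam M X v)

/-- Free variables of an Inclusion Logic formula. -/
def fvInc : IncForm L → Set ℕ
  | .rel _ ts => ⋃ i, tvars (ts i)
  | .nrel _ ts => ⋃ i, tvars (ts i)
  | .eq t u => tvars t ∪ tvars u
  | .neq t u => tvars t ∪ tvars u
  | .incl ts us => (⋃ i, tvars (ts i)) ∪ ⋃ i, tvars (us i)
  | .and φ ψ => fvInc φ ∪ fvInc ψ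
  | .or φ ψ => fvInc φ ∪ fvInc ψ
  | .ex v φ => fvInc φ \ {v}
  | .all v φ => fvInc φ \ {v}

/-- Truth of an FO(⊆) sentence in a model: satisfaction by the team consisting of the
empty assignment (encoded, with total assignments, as the singleton team `{s}` for
every `s`; for sentences all these coincide). -/
def incTrue (M : Type*) [L.Structure M] (φ : IncForm L) : Prop :=
  ∀ s : ℕ → M, teamSat M φ {s}

/-- The relation `X(x̄)` of values of a team, for `x̄ = (x_0, …, x_{n-1})` where we use
the variables `0, …, n-1` for `x₁, …, xₙ`. -/
def teamRel (n : ℕ) {M : Type*} (X : Set (ℕ → M)) : Set (Fin n → M) :=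
  {a | ∃ s ∈ X, a = fun j : Fin n => s (j : ℕ)}

end TeamSem

namespace TeamSem

/-- The signature with a single binary relation symbol `E`. -/
def Lgraph : Language := ⟨fun _ => Empty, fun k => PLift (k = 2)⟩

/-- The binary relation symbol `E` of `Lgraph`. -/
def Esym : Lgraph.Relations 2 := PLift.up rfl

/-- The FO(⊆) sentence `∃x ∃y (y ⊆ x ∧ E x y)`, with `x` as variable `0`
and `y` as variable `1`. -/
def cycleSentence : IncForm Lgraph :=
  .ex 0 (.ex 1 (.and
    (.incl (fun _ : Fin 1 => Term.var 1) (fun _ : Fin 1 => Term.var 0))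
    (.rel Esym (fun i : Fin 2 => Term.var (i : ℕ)))))

end TeamSem

namespace TeamSem

/-- If every point of a nonempty set in a finite type has an `r`-successor in the set, then
`r` has a cycle. -/
theorem exists_cycle_of_forall_exists_rel {α : Type*} [Finite α] {r : α → α → Prop} {S : Set α}
    (hne : S.Nonempty) (hS : ∀ x ∈ S, ∃ y ∈ S, r x y) :
    ∃ (k : ℕ) (a : Fin (k + 1) → α), ∀ i, r (a i) (a (i + 1)) := by
  obtain ⟨x₀, hx₀⟩ := hne
  choose! f hfS hfr using hS
  have hmem : ∀ n, f^[n] x₀ ∈ S := by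
    intro n
    induction n with
    | zero => exact hx₀
    | succ n ih => rw [Function.iterate_succ_apply']; exact hfS _ ih
  have hstep : ∀ n, r (f^[n] x₀) (f^[n + 1] x₀) := by
    intro n
    rw [Function.iterate_succ_apply']
    exact hfr _ (hmem n)
  obtain ⟨m, n, hlt, heq⟩ : ∃ m n, m < n ∧ f^[m] x₀ = f^[n] x₀ := by
    obtain ⟨m, n, hne, heq⟩ := Finite.exists_ne_map_eq_of_infinite fun n : ℕ => f^[n] x₀
    rcases hne.lt_or_gt with h | h
    · exact ⟨m, n, h, heq⟩
    · exact ⟨n, m, h, heq.symm⟩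
  obtain ⟨k, rfl⟩ := Nat.exists_eq_add_of_lt hlt
  refine ⟨k, fun i => f^[m + i] x₀, fun i => ?_⟩
  have h := hstep (m + i)
  rcases Fin.eq_castSucc_or_eq_last i with ⟨j, rfl⟩ | rfl
  · have hj : ((j.castSucc + 1 : Fin (k + 1)) : ℕ) = j + 1 := by
      rw [Fin.val_add_one_of_lt (Fin.castSucc_lt_last j)]; rfl
    simpa only [hj, Fin.val_castSucc, ← add_assoc] using h
  · simp only [Fin.last_add_one, Fin.val_zero, Fin.val_last, add_zero] at h ⊢
    rwa [heq]

/-- A team over which `y ⊆ x ∧ Exy` holds. -/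
theorem teamSat_incl_and_rel_iff {M : Type*} [Lgraph.Structure M] (X : Set (ℕ → M)) :
    teamSat M (.and
      (.incl (fun _ : Fin 1 => Term.var 1) (fun _ : Fin 1 => Term.var 0))
      (.rel Esym (fun i : Fin 2 => Term.var (i : ℕ)))) X ↔
      (∀ s ∈ X, ∃ s' ∈ X, s 1 = s' 0) ∧ ∀ s ∈ X, Structure.RelMap Esym ![s 0, s 1] := by
  have hpair (s : ℕ → M) : (fun i : Fin 2 => s i) = ![s 0, s 1] := by
    ext i; fin_cases i <;> rfl
  simp only [teamSat, Term.realize_var, hpair, forall_const]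

end TeamSem

open TeamSem in
/-- a finite model `M` with one binary relation `E` satisfies the
inclusion logic sentence `∃x∃y(y ⊆ x ∧ Exy)` iff `E^M` contains a cycle, i.e. there are
`n ≥ 1` and `a₀, …, a_{n-1}` with `(aᵢ, a_{i+1 mod n}) ∈ E^M` for all `i`. -/
theorem inclusion_sentence_iff_cycle (M : Type*) [Fintype M] [Nonempty M]
    [Lgraph.Structure M] :
    incTrue M cycleSentence ↔
      ∃ (k : ℕ) (a : Fin (k + 1) → M), ∀ i : Fin (k + 1),
        Structure.RelMap Esym ![a i, a (i + 1)] := by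
  constructor
  · intro h
    obtain ⟨c⟩ := ‹Nonempty M›
    obtain ⟨H, hH, K, hK, hsat⟩ := h fun _ => c
    obtain ⟨hincl, hrel⟩ := (teamSat_incl_and_rel_iff _).1 hsat
    set X := suppTeam (suppTeam {fun _ => c} H 0) K 1
    have hX : X.Nonempty := by
      obtain ⟨m, hm⟩ := hH _ rfl
      have hs : Function.update (fun _ => c) 0 m ∈ suppTeam {fun _ => c} H 0 :=
        ⟨_, rfl, m, hm, rfl⟩
      obtain ⟨m', hm'⟩ := hK _ hs
      exact ⟨_, _, hs, m', hm', rfl⟩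
    refine exists_cycle_of_forall_exists_rel (r := fun x y => Structure.RelMap Esym ![x, y])
      (S := (fun s : ℕ → M => s 0) '' X) (hX.image _) ?_
    rintro _ ⟨s, hs, rfl⟩
    obtain ⟨s', hs', hss'⟩ := hincl s hs
    exact ⟨s 1, ⟨s', hs', hss'.symm⟩, hrel s hs⟩
  · rintro ⟨k, a, ha⟩ s
    refine ⟨fun _ => range a, fun _ _ => range_nonempty a,
      fun t => {y | ∃ i, t 0 = a i ∧ y = a (i + 1)}, ?_, (teamSat_incl_and_rel_iff _).2 ⟨?_, ?_⟩⟩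
    · rintro _ ⟨_, -, _, ⟨i, rfl⟩, rfl⟩
      exact ⟨a (i + 1), i, by simp, rfl⟩
    · rintro _ ⟨_, -, _, ⟨i, -, rfl⟩, rfl⟩
      refine ⟨_, ⟨_, ⟨s, rfl, a (i + 1), ⟨i + 1, rfl⟩, rfl⟩,
        a (i + 1 + 1), ⟨i + 1, by simp, rfl⟩, rfl⟩, by simp⟩
    · rintro _ ⟨t, -, _, ⟨i, hi, rfl⟩, rfl⟩
      simpa [hi] using ha i
end

section
/- For every Inclusion Logic formula φ(x̄) with free variables among x̄ = (x₁,…,xₙ) there exists a Positive Greatest Fixed Point Logic formula φ*(R, x̄), where R is an n-ary relation symbol occurring only positively in φ*, such that for all structures M and all teams X over M with domain {x₁,…,xₙ}: M ⊨_X φ(x̄) if and only if (M, X(x̄)) ⊨_s φ*(R, x̄) for all s ∈ X. -/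
open FirstOrder Language Set

namespace TeamSem

/-- Interpretations of second-order relation variables: relation variable number `i`
of arity `k` is interpreted as `I k i`. -/
def RelInterp (M : Type*) : Type _ := (k : ℕ) → ℕ → Set (Fin k → M)

/-- The trivial interpretation (all relation variables empty). -/
def botI (M : Type*) : RelInterp M := fun _ _ => ∅

/-- Update the interpretation of relation variable `i` of arity `n` to `Q`. -/
def updI {M : Type*} (I : RelInterp M) (n i : ℕ) (Q : Set (Fin n → M)) : RelInterp M :=
  fun k j => {a | if h : k = n ∧ j = i then (fun m => a (Fin.cast h.1.symm m)) ∈ Q else a ∈ I k j}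

/-- Simultaneous update of an assignment on the variables `xs` by the tuple `a`. -/
noncomputable def updVec {M : Type*} (s : ℕ → M) {n : ℕ} (xs : Fin n → ℕ)
    (a : Fin n → M) : ℕ → M :=
  fun v => if h : ∃ j, xs j = v then a h.choose else s v

/-- Formulas of Positive Greatest Fixed Point Logic (PGFP) in negation normal form:
second-order relation variables (`rvar i`, of arity `n`) and the `gfp` operator can occur
only positively (there are no negated `rvar`/`gfp` constructors). -/
inductive GFPForm (L : Language) where
  | rel {n : ℕ} (R : L.Relations n) (ts : Fin n → L.Term ℕ)
  | nrel {n : ℕ} (R : L.Relations n) (ts : Fin n → L.Term ℕ)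
  | eq (t u : L.Term ℕ)
  | neq (t u : L.Term ℕ)
  | rvar (i : ℕ) {n : ℕ} (ts : Fin n → L.Term ℕ)
  | and (φ ψ : GFPForm L)
  | or (φ ψ : GFPForm L)
  | ex (v : ℕ) (φ : GFPForm L)
  | all (v : ℕ) (φ : GFPForm L)
  | gfp (i n : ℕ) (xs : Fin n → ℕ) (φ : GFPForm L) (ts : Fin n → L.Term ℕ)

variable {L : Language}

/-- Tarski semantics for PGFP.  The clause for `gfp i n xs φ ts` uses the Knaster–Tarski
characterization: the greatest fixed point of the monotone operator
`Γ(Q) = {ā | (M, Q/i) ⊨ φ(ā)}` equals `⋃ {Q | Q ⊆ Γ(Q)}`. -/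
def gsat (M : Type*) [L.Structure M] : GFPForm L → RelInterp M → (ℕ → M) → Prop
  | .rel R ts, _, s => Structure.RelMap R fun i => (ts i).realize s
  | .nrel R ts, _, s => ¬ Structure.RelMap R fun i => (ts i).realize s
  | .eq t u, _, s => t.realize s = u.realize s
  | .neq t u, _, s => t.realize s ≠ u.realize s
  | .rvar i ts, I, s => (fun j => (ts j).realize s) ∈ I _ i
  | .and φ ψ, I, s => gsat M φ I s ∧ gsat M ψ I s
  | .or φ ψ, I, s => gsat M φ I s ∨ gsat M ψ I s
  | .ex v φ, I, s => ∃ m : M, gsat M φ I (Function.update s v m)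
  | .all v φ, I, s => ∀ m : M, gsat M φ I (Function.update s v m)
  | .gfp i n xs φ ts, I, s =>
      (fun j => (ts j).realize s) ∈
        ⋃₀ {Q : Set (Fin n → M) | Q ⊆ {a | gsat M φ (updI I n i Q) (updVec s xs a)}}

/-- Free first-order variables of a PGFP formula. -/
def fvG : GFPForm L → Set ℕ
  | .rel _ ts => ⋃ i, tvars (ts i)
  | .nrel _ ts => ⋃ i, tvars (ts i)
  | .eq t u => tvars t ∪ tvars u
  | .neq t u => tvars t ∪ tvars u
  | .rvar _ ts => ⋃ i, tvars (ts i)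
  | .and φ ψ => fvG φ ∪ fvG ψ
  | .or φ ψ => fvG φ ∪ fvG ψ
  | .ex v φ => fvG φ \ {v}
  | .all v φ => fvG φ \ {v}
  | .gfp _ _ xs φ ts => (⋃ i, tvars (ts i)) ∪ (fvG φ \ Set.range fun j => xs j)

/-- All first-order variables (free or bound) occurring in a PGFP formula. -/
def avG : GFPForm L → Set ℕ
  | .rel _ ts => ⋃ i, tvars (ts i)
  | .nrel _ ts => ⋃ i, tvars (ts i)
  | .eq t u => tvars t ∪ tvars u
  | .neq t u => tvars t ∪ tvars u
  | .rvar _ ts => ⋃ i, tvars (ts i)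
  | .and φ ψ => avG φ ∪ avG ψ
  | .or φ ψ => avG φ ∪ avG ψ
  | .ex v φ => {v} ∪ avG φ
  | .all v φ => {v} ∪ avG φ
  | .gfp _ _ xs φ ts => (⋃ i, tvars (ts i)) ∪ (Set.range fun j => xs j) ∪ avG φ

/-- Free relation variables of a PGFP formula, together with their arities. -/
def rvG : GFPForm L → Set (ℕ × ℕ)
  | @GFPForm.rvar _ i n _ => {(i, n)}
  | .and φ ψ => rvG φ ∪ rvG ψ
  | .or φ ψ => rvG φ ∪ rvG ψ
  | .ex _ φ => rvG φ
  | .all _ φ => rvG φ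
  | .gfp i n _ φ _ => rvG φ \ {(i, n)}
  | _ => ∅

/-- PGFP formulas containing no `gfp` operator, i.e. first-order formulas
(possibly mentioning relation variables positively). -/
def NoGfp : GFPForm L → Prop
  | .and φ ψ => NoGfp φ ∧ NoGfp ψ
  | .or φ ψ => NoGfp φ ∧ NoGfp ψ
  | .ex _ φ => NoGfp φ
  | .all _ φ => NoGfp φ
  | .gfp .. => False
  | _ => True

end TeamSem

namespace TeamSem

section Terms

variable {L : Language} {M : Type*} [L.Structure M]

lemma realize_congr_tvars (t : L.Term ℕ) {s s' : ℕ → M} (h : EqOn s s' (tvars t)) :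
    t.realize s = t.realize s' := by
  induction t with
  | var v => exact h rfl
  | func f ts ih =>
    simp only [Term.realize]
    congr 1
    funext i
    exact ih i fun v hv => h (by simp only [tvars, mem_iUnion]; exact ⟨i, hv⟩)

lemma tvars_relabel (g : ℕ → ℕ) (t : L.Term ℕ) : tvars (t.relabel g) = g '' tvars t := by
  induction t with
  | var v => simp [tvars, Term.relabel]
  | func f ts ih => simp [tvars, Term.relabel, ih, image_iUnion]

end Terms

section Teams

variable {L : Language} {M : Type*}

/-- Two teams have the same restrictions to the variables in `V`. -/
def AgreeOn (V : Set ℕ) (X Y : Set (ℕ → M)) : Prop :=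
  (∀ s ∈ X, ∃ t ∈ Y, EqOn s t V) ∧ ∀ t ∈ Y, ∃ s ∈ X, EqOn s t V

lemma AgreeOn.mono {V W : Set ℕ} {X Y : Set (ℕ → M)} (h : AgreeOn V X Y) (hW : W ⊆ V) :
    AgreeOn W X Y := by
  refine ⟨fun s hs => ?_, fun t ht => ?_⟩
  · obtain ⟨t, ht, e⟩ := h.1 s hs
    exact ⟨t, ht, e.mono hW⟩
  · obtain ⟨s, hs, e⟩ := h.2 t ht
    exact ⟨s, hs, e.mono hW⟩

lemma eqOn_update {V : Set ℕ} {v : ℕ} {s t : ℕ → M} (h : EqOn s t (V \ {v})) (m : M) :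
    EqOn (Function.update s v m) (Function.update t v m) V := by
  intro w hw
  by_cases hv : w = v
  · simp [hv]
  · simpa [hv] using h ⟨hw, hv⟩

variable [L.Structure M]

/-- Lax team semantics is local: satisfaction depends only on the free variables. -/
lemma teamSat_of_agreeOn (φ : IncForm L) {X Y : Set (ℕ → M)} (h : AgreeOn (fvInc φ) X Y)
    (hX : teamSat M φ X) : teamSat M φ Y := by
  have sub {n : ℕ} (ts : Fin n → L.Term ℕ) (i : Fin n) : tvars (ts i) ⊆ ⋃ i, tvars (ts i) :=
    subset_iUnion (fun i => tvars (ts i)) i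
  induction φ generalizing X Y with
  | rel R ts =>
    intro t ht
    obtain ⟨s, hs, e⟩ := h.2 t ht
    have := hX s hs
    rwa [funext fun i => realize_congr_tvars (ts i) (e.mono (sub ts i))] at this
  | nrel R ts =>
    intro t ht
    obtain ⟨s, hs, e⟩ := h.2 t ht
    have := hX s hs
    rwa [funext fun i => realize_congr_tvars (ts i) (e.mono (sub ts i))] at this
  | eq t u =>
    intro s' hs'
    obtain ⟨s, hs, e⟩ := h.2 s' hs'
    rw [← realize_congr_tvars t (e.mono subset_union_left),
      ← realize_congr_tvars u (e.mono subset_union_right)]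
    exact hX s hs
  | neq t u =>
    intro s' hs'
    obtain ⟨s, hs, e⟩ := h.2 s' hs'
    rw [← realize_congr_tvars t (e.mono subset_union_left),
      ← realize_congr_tvars u (e.mono subset_union_right)]
    exact hX s hs
  | incl ts us =>
    intro t ht
    obtain ⟨s, hs, e⟩ := h.2 t ht
    obtain ⟨s', hs', e'⟩ := hX s hs
    obtain ⟨t', ht', e''⟩ := h.1 s' hs'
    refine ⟨t', ht', fun i => ?_⟩
    rw [← realize_congr_tvars (ts i) (e.mono ((sub ts i).trans subset_union_left)),
      ← realize_congr_tvars (us i) (e''.mono ((sub us i).trans subset_union_right))]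
    exact e' i
  | and φ ψ ihφ ihψ =>
    exact ⟨ihφ (h.mono subset_union_left) hX.1, ihψ (h.mono subset_union_right) hX.2⟩
  | or φ ψ ihφ ihψ =>
    obtain ⟨X₁, X₂, rfl, h₁, h₂⟩ := hX
    refine ⟨{t ∈ Y | ∃ s ∈ X₁, EqOn s t (fvInc φ ∪ fvInc ψ)},
      {t ∈ Y | ∃ s ∈ X₂, EqOn s t (fvInc φ ∪ fvInc ψ)}, ?_, ihφ ?_ h₁, ihψ ?_ h₂⟩
    · ext t
      constructor
      · intro ht
        obtain ⟨s, hs | hs, e⟩ := h.2 t ht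
        · exact Or.inl ⟨ht, s, hs, e⟩
        · exact Or.inr ⟨ht, s, hs, e⟩
      · rintro (ht | ht) <;> exact ht.1
    · refine AgreeOn.mono ⟨fun s hs => ?_, fun t ht => ht.2⟩ subset_union_left
      obtain ⟨t, ht, e⟩ := h.1 s (Or.inl hs)
      exact ⟨t, ⟨ht, s, hs, e⟩, e⟩
    · refine AgreeOn.mono ⟨fun s hs => ?_, fun t ht => ht.2⟩ subset_union_right
      obtain ⟨t, ht, e⟩ := h.1 s (Or.inr hs)
      exact ⟨t, ⟨ht, s, hs, e⟩, e⟩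
  | ex v φ ih =>
    obtain ⟨H, hH, hφ⟩ := hX
    refine ⟨fun t => {m | ∃ s ∈ X, EqOn s t (fvInc φ \ {v}) ∧ m ∈ H s}, fun t ht => ?_,
      ih ⟨?_, ?_⟩ hφ⟩
    · obtain ⟨s, hs, e⟩ := h.2 t ht
      obtain ⟨m, hm⟩ := hH s hs
      exact ⟨m, s, hs, e, hm⟩
    · rintro _ ⟨s, hs, m, hm, rfl⟩
      obtain ⟨t, ht, e⟩ := h.1 s hs
      exact ⟨_, ⟨t, ht, m, ⟨s, hs, e, hm⟩, rfl⟩, eqOn_update e m⟩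
    · rintro _ ⟨t, ht, m, ⟨s, hs, e, hm⟩, rfl⟩
      exact ⟨_, ⟨s, hs, m, hm, rfl⟩, eqOn_update e m⟩
  | all v φ ih =>
    refine ih ⟨?_, ?_⟩ hX
    · rintro _ ⟨s, hs, m, rfl⟩
      obtain ⟨t, ht, e⟩ := h.1 s hs
      exact ⟨_, ⟨t, ht, m, rfl⟩, eqOn_update e m⟩
    · rintro _ ⟨t, ht, m, rfl⟩
      obtain ⟨s, hs, e⟩ := h.2 t ht
      exact ⟨_, ⟨s, hs, m, rfl⟩, eqOn_update e m⟩

/-- Inclusion Logic is closed under unions of teams. -/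
lemma teamSat_sUnion (φ : IncForm L) {𝒳 : Set (Set (ℕ → M))} (h : ∀ X ∈ 𝒳, teamSat M φ X) :
    teamSat M φ (⋃₀ 𝒳) := by
  induction φ generalizing 𝒳 with
  | rel R ts => rintro s ⟨X, hX, hs⟩; exact h X hX s hs
  | nrel R ts => rintro s ⟨X, hX, hs⟩; exact h X hX s hs
  | eq t u => rintro s ⟨X, hX, hs⟩; exact h X hX s hs
  | neq t u => rintro s ⟨X, hX, hs⟩; exact h X hX s hs
  | incl ts us =>
    rintro s ⟨X, hX, hs⟩
    obtain ⟨s', hs', e⟩ := h X hX s hs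
    exact ⟨s', ⟨X, hX, hs'⟩, e⟩
  | and φ ψ ihφ ihψ => exact ⟨ihφ fun X hX => (h X hX).1, ihψ fun X hX => (h X hX).2⟩
  | or φ ψ ihφ ihψ =>
    refine ⟨⋃₀ {Y | teamSat M φ Y ∧ ∃ X ∈ 𝒳, Y ⊆ X}, ⋃₀ {Z | teamSat M ψ Z ∧ ∃ X ∈ 𝒳, Z ⊆ X},
      ?_, ihφ fun Y hY => hY.1, ihψ fun Z hZ => hZ.1⟩
    ext s
    constructor
    · rintro ⟨X, hX, hs⟩
      obtain ⟨Y, Z, rfl, hY, hZ⟩ := h X hX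
      rcases hs with hs | hs
      · exact Or.inl ⟨Y, ⟨hY, _, hX, subset_union_left⟩, hs⟩
      · exact Or.inr ⟨Z, ⟨hZ, _, hX, subset_union_right⟩, hs⟩
    · rintro (⟨Y, ⟨-, X, hX, hY⟩, hs⟩ | ⟨Y, ⟨-, X, hX, hY⟩, hs⟩) <;> exact ⟨X, hX, hY hs⟩
  | ex v φ ih =>
    choose! H hH hφ using h
    have e : suppTeam (⋃₀ 𝒳) (fun s => {m | ∃ X ∈ 𝒳, s ∈ X ∧ m ∈ H X s}) v =
        ⋃₀ ((fun X => suppTeam X (H X) v) '' 𝒳) := by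
      ext t
      constructor
      · rintro ⟨s, -, m, ⟨X, hX, hs, hm⟩, rfl⟩
        exact ⟨_, ⟨X, hX, rfl⟩, s, hs, m, hm, rfl⟩
      · rintro ⟨_, ⟨X, hX, rfl⟩, s, hs, m, hm, rfl⟩
        exact ⟨s, ⟨X, hX, hs⟩, m, ⟨X, hX, hs, hm⟩, rfl⟩
    refine ⟨fun s => {m | ∃ X ∈ 𝒳, s ∈ X ∧ m ∈ H X s}, ?_, ?_⟩
    · rintro s ⟨X, hX, hs⟩
      obtain ⟨m, hm⟩ := hH X hX s hs
      exact ⟨m, X, hX, hs, hm⟩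
    · rw [e]
      refine ih ?_
      rintro _ ⟨X, hX, rfl⟩
      exact hφ X hX
  | all v φ ih =>
    have e : dupTeam M (⋃₀ 𝒳) v = ⋃₀ ((fun X => dupTeam M X v) '' 𝒳) := by
      ext t
      constructor
      · rintro ⟨s, ⟨X, hX, hs⟩, m, rfl⟩
        exact ⟨_, ⟨X, hX, rfl⟩, s, hs, m, rfl⟩
      · rintro ⟨_, ⟨X, hX, rfl⟩, s, hs, m, rfl⟩
        exact ⟨s, ⟨X, hX, hs⟩, m, rfl⟩
    change teamSat M φ (dupTeam M (⋃₀ 𝒳) v)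
    rw [e]
    refine ih ?_
    rintro _ ⟨X, hX, rfl⟩
    exact h X hX

end Teams

section Cylinders

variable {M : Type*} {N : ℕ}

/-- The tuple of values of the variables below `N`. -/
def restr (N : ℕ) (s : ℕ → M) : Fin N → M := fun j => s j

/-- The team of all assignments whose values below `N` form a tuple in `Q`. -/
def cyl (Q : Set (Fin N → M)) : Set (ℕ → M) := {s | restr N s ∈ Q}

/-- The assignment `s` with its values below `N` replaced by `a`. -/
noncomputable abbrev overwrite (s : ℕ → M) (a : Fin N → M) : ℕ → M :=
  updVec s (fun j : Fin N => (j : ℕ)) a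

lemma overwrite_apply_fin (s : ℕ → M) (a : Fin N → M) (j : Fin N) : overwrite s a j = a j := by
  have h : ∃ k : Fin N, (k : ℕ) = j := ⟨j, rfl⟩
  simp only [overwrite, updVec, dif_pos h]
  exact congrArg a (Fin.ext h.choose_spec)

@[simp]
lemma restr_overwrite (s : ℕ → M) (a : Fin N → M) : restr N (overwrite s a) = a :=
  funext fun j => overwrite_apply_fin s a j

lemma eqOn_of_restr_eq {s t : ℕ → M} (h : restr N s = restr N t) : EqOn s t {v | v < N} :=
  fun v hv => congrFun h ⟨v, hv⟩

lemma restr_update_congr {s t : ℕ → M} (h : restr N s = restr N t) (v : ℕ) (m : M) :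
    restr N (Function.update s v m) = restr N (Function.update t v m) :=
  funext fun j => eqOn_update ((eqOn_of_restr_eq h).mono sdiff_subset) m j.2

lemma agreeOn_cyl_teamRel (X : Set (ℕ → M)) : AgreeOn {v | v < N} X (cyl (teamRel N X)) := by
  refine ⟨fun s hs => ⟨s, ⟨s, hs, rfl⟩, fun _ _ => rfl⟩, ?_⟩
  rintro t ⟨s, hs, e⟩
  exact ⟨s, hs, eqOn_of_restr_eq (N := N) e.symm⟩

lemma updI_same (I : RelInterp M) (n i : ℕ) (Q : Set (Fin n → M)) : updI I n i Q n i = Q := by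
  ext a
  simp [updI]

lemma updI_of_ne (I : RelInterp M) (n i : ℕ) (Q : Set (Fin n → M)) {k j : ℕ} (h : j ≠ i) :
    updI I n i Q k j = I k j := by
  ext a
  simp [updI, h]

end Cylinders

section Translation

variable {L : Language}

/-- The tuple of the first `N` variables, as terms. -/
def varTuple (L : Language) (N : ℕ) : Fin N → L.Term ℕ := fun j => Term.var (j : ℕ)

/-- Existential quantification over the variables `n, …, n + k - 1`. -/
def exBlock (n : ℕ) : ℕ → GFPForm L → GFPForm L
  | 0, ψ => ψ
  | k + 1, ψ => .ex (n + k) (exBlock n k ψ)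

/-- The greatest fixed point over the first `N` variables of `χ ∧ ψ`, applied to these variables. -/
def gfpAnd (N i : ℕ) (χ ψ : GFPForm L) : GFPForm L :=
  .gfp i N (fun j => (j : ℕ)) (.and χ ψ) (varTuple L N)

/-- The translation of Inclusion Logic into PGFP, with the team encoded by the relation
variable `i` of arity `N`. -/
def toGFP (N : ℕ) : IncForm L → ℕ → GFPForm L
  | .rel R ts, _ => .rel R ts
  | .nrel R ts, _ => .nrel R ts
  | .eq t u, _ => .eq t u
  | .neq t u, _ => .neq t u
  | .incl ts us, i => exBlock N N <|
      (List.ofFn fun j => GFPForm.eq (ts j) ((us j).relabel (N + ·))).foldr .and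
        (.rvar i fun j : Fin N => Term.var (N + j))
  | .and φ ψ, i => .and (toGFP N φ i) (toGFP N ψ i)
  | .or φ ψ, i => .or (gfpAnd N (i + 1) (.rvar i (varTuple L N)) (toGFP N φ (i + 1)))
      (gfpAnd N (i + 1) (.rvar i (varTuple L N)) (toGFP N ψ (i + 1)))
  | .ex v φ, i => .ex v <|
      gfpAnd N (i + 1) (.ex v (.rvar i (varTuple L N))) (toGFP N φ (i + 1))
  | .all v φ, i => .all v <|
      gfpAnd N (i + 1) (.ex v (.rvar i (varTuple L N))) (toGFP N φ (i + 1))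

/-- A strict upper bound for the quantified variables. -/
def boundVarBound : IncForm L → ℕ
  | .and φ ψ => max (boundVarBound φ) (boundVarBound ψ)
  | .or φ ψ => max (boundVarBound φ) (boundVarBound ψ)
  | .ex v φ => max (v + 1) (boundVarBound φ)
  | .all v φ => max (v + 1) (boundVarBound φ)
  | _ => 0

lemma fvG_exBlock (n k : ℕ) (ψ : GFPForm L) :
    fvG (exBlock n k ψ) = fvG ψ \ {v | n ≤ v ∧ v < n + k} := by
  induction k with
  | zero =>
    ext v
    simp only [exBlock, mem_sdiff, mem_ofPred_eq]
    exact ⟨fun h => ⟨h, by omega⟩, fun h => h.1⟩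
  | succ k ih =>
    ext v
    simp only [exBlock, fvG, ih, mem_sdiff, mem_ofPred_eq, mem_singleton_iff]
    constructor
    · rintro ⟨⟨h, h'⟩, h''⟩
      exact ⟨h, by omega⟩
    · rintro ⟨h, h'⟩
      exact ⟨⟨h, by omega⟩, by omega⟩

lemma rvG_exBlock (n k : ℕ) (ψ : GFPForm L) : rvG (exBlock n k ψ) = rvG ψ := by
  induction k with
  | zero => rfl
  | succ k ih => exact ih

lemma fvG_foldr_and (l : List (GFPForm L)) (χ : GFPForm L) {V : Set ℕ} (hl : ∀ ψ ∈ l, fvG ψ ⊆ V)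
    (hχ : fvG χ ⊆ V) : fvG (l.foldr .and χ) ⊆ V := by
  induction l with
  | nil => exact hχ
  | cons ψ l ih =>
    exact union_subset (hl ψ (by simp)) (ih fun θ hθ => hl θ (by simp [hθ]))

lemma rvG_foldr_and (l : List (GFPForm L)) (χ : GFPForm L) {V : Set (ℕ × ℕ)}
    (hl : ∀ ψ ∈ l, rvG ψ ⊆ V) (hχ : rvG χ ⊆ V) : rvG (l.foldr .and χ) ⊆ V := by
  induction l with
  | nil => exact hχ
  | cons ψ l ih =>
    exact union_subset (hl ψ (by simp)) (ih fun θ hθ => hl θ (by simp [hθ]))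

lemma tvars_varTuple_subset (N : ℕ) : ⋃ i, tvars (varTuple L N i) ⊆ {v | v < N} := by
  rintro v hv
  obtain ⟨j, rfl⟩ := mem_iUnion.1 hv
  exact j.2

lemma fvG_gfpAnd_subset {N i : ℕ} {χ ψ : GFPForm L} (hχ : fvG χ ⊆ {v | v < N})
    (hψ : fvG ψ ⊆ {v | v < N}) : fvG (gfpAnd N i χ ψ) ⊆ {v | v < N} :=
  union_subset (tvars_varTuple_subset N) (sdiff_subset.trans (union_subset hχ hψ))

lemma rvG_gfpAnd_subset {N i : ℕ} {χ ψ : GFPForm L} {V : Set (ℕ × ℕ)} (hχ : rvG χ ⊆ V)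
    (hψ : rvG ψ ⊆ {(i, N)}) : rvG (gfpAnd N i χ ψ) ⊆ V := by
  rintro p ⟨hp | hp, h⟩
  · exact hχ hp
  · exact absurd (hψ hp) h

lemma fvInc_subset_of_diff {φ : IncForm L} {N v : ℕ} (h : fvInc φ \ {v} ⊆ {w | w < N})
    (hv : v < N) : fvInc φ ⊆ {w | w < N} := by
  intro w hw
  by_cases e : w = v
  · exact e ▸ hv
  · exact h ⟨hw, e⟩

lemma fvG_toGFP_subset {N : ℕ} (φ : IncForm L) (hfv : fvInc φ ⊆ {v | v < N})
    (hb : boundVarBound φ ≤ N) (i : ℕ) : fvG (toGFP N φ i) ⊆ {v | v < N} := by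
  induction φ generalizing i with
  | rel R ts => exact hfv
  | nrel R ts => exact hfv
  | eq t u => exact hfv
  | neq t u => exact hfv
  | incl ts us =>
    have hsub : fvG ((List.ofFn fun j => GFPForm.eq (ts j) ((us j).relabel (N + ·))).foldr .and
        (.rvar i fun j : Fin N => Term.var (N + j))) ⊆ {v | v < N + N} := by
      refine fvG_foldr_and _ _ ?_ ?_
      · intro ψ hψ
        obtain ⟨j, rfl⟩ := List.mem_ofFn.1 hψ
        refine union_subset (fun v hv => ?_) ?_
        · have : v < N := hfv (Or.inl (mem_iUnion.2 ⟨j, hv⟩))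
          exact lt_of_lt_of_le this (by omega)
        · rw [tvars_relabel]
          rintro _ ⟨v, hv, rfl⟩
          have : v < N := hfv (Or.inr (mem_iUnion.2 ⟨j, hv⟩))
          simpa using this
      · rintro v hv
        obtain ⟨j, rfl⟩ := mem_iUnion.1 hv
        exact Nat.add_lt_add_left j.2 N
    rw [toGFP, fvG_exBlock]
    rintro v ⟨hv, hv'⟩
    have : v < N + N := hsub hv
    simp only [mem_ofPred_eq] at hv' ⊢
    omega
  | and φ ψ ihφ ihψ =>
    exact union_subset (ihφ (subset_union_left.trans hfv) (le_of_max_le_left hb) i)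
      (ihψ (subset_union_right.trans hfv) (le_of_max_le_right hb) i)
  | or φ ψ ihφ ihψ =>
    exact union_subset
      (fvG_gfpAnd_subset (tvars_varTuple_subset N)
        (ihφ (subset_union_left.trans hfv) (le_of_max_le_left hb) _))
      (fvG_gfpAnd_subset (tvars_varTuple_subset N)
        (ihψ (subset_union_right.trans hfv) (le_of_max_le_right hb) _))
  | ex v φ ih =>
    exact sdiff_subset.trans (fvG_gfpAnd_subset (sdiff_subset.trans (tvars_varTuple_subset N))
      (ih (fvInc_subset_of_diff hfv (le_of_max_le_left hb)) (le_of_max_le_right hb) _))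
  | all v φ ih =>
    exact sdiff_subset.trans (fvG_gfpAnd_subset (sdiff_subset.trans (tvars_varTuple_subset N))
      (ih (fvInc_subset_of_diff hfv (le_of_max_le_left hb)) (le_of_max_le_right hb) _))

lemma rvG_toGFP_subset (N : ℕ) (φ : IncForm L) (i : ℕ) : rvG (toGFP N φ i) ⊆ {(i, N)} := by
  induction φ generalizing i with
  | rel R ts => exact empty_subset _
  | nrel R ts => exact empty_subset _
  | eq t u => exact empty_subset _
  | neq t u => exact empty_subset _
  | incl ts us =>
    rw [toGFP, rvG_exBlock]
    refine rvG_foldr_and _ _ (fun ψ hψ => ?_) subset_rfl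
    obtain ⟨j, rfl⟩ := List.mem_ofFn.1 hψ
    exact empty_subset _
  | and φ ψ ihφ ihψ => exact union_subset (ihφ i) (ihψ i)
  | or φ ψ ihφ ihψ =>
    exact union_subset (rvG_gfpAnd_subset subset_rfl (ihφ _)) (rvG_gfpAnd_subset subset_rfl (ihψ _))
  | ex v φ ih => exact rvG_gfpAnd_subset subset_rfl (ih _)
  | all v φ ih => exact rvG_gfpAnd_subset subset_rfl (ih _)

variable {M : Type*} [L.Structure M]

lemma gsat_exBlock (n k : ℕ) (ψ : GFPForm L) (I : RelInterp M) (s : ℕ → M) :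
    gsat M (exBlock n k ψ) I s ↔
      ∃ t, (∀ v, ¬ (n ≤ v ∧ v < n + k) → t v = s v) ∧ gsat M ψ I t := by
  induction k generalizing s with
  | zero =>
    constructor
    · exact fun h => ⟨s, fun _ _ => rfl, h⟩
    · rintro ⟨t, e, h⟩
      obtain rfl : t = s := funext fun v => e v (by omega)
      exact h
  | succ k ih =>
    simp only [exBlock, gsat, ih]
    constructor
    · rintro ⟨m, t, e, h⟩
      refine ⟨t, fun v hv => ?_, h⟩
      rw [e v (by omega), Function.update_of_ne (by omega)]
    · rintro ⟨t, e, h⟩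
      refine ⟨t (n + k), t, fun v hv => ?_, h⟩
      by_cases hvk : v = n + k
      · simp [hvk]
      · rw [Function.update_of_ne hvk, e v (by omega)]

lemma gsat_foldr_and (l : List (GFPForm L)) (χ : GFPForm L) (I : RelInterp M) (s : ℕ → M) :
    gsat M (l.foldr .and χ) I s ↔ (∀ ψ ∈ l, gsat M ψ I s) ∧ gsat M χ I s := by
  induction l with
  | nil => simp
  | cons ψ l ih => simp [gsat, ih, and_assoc]

lemma realize_varTuple (N : ℕ) (s : ℕ → M) :
    (fun j => (varTuple L N j).realize s) = restr N s := rfl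

/-- `toGFP N φ i` correctly describes satisfaction of `φ` in all teams that depend only on the
variables below `N`. -/
def Correct (M : Type*) [L.Structure M] (N : ℕ) (φ : IncForm L) (i : ℕ) : Prop :=
  ∀ (I : RelInterp M) (s : ℕ → M),
    teamSat M φ (cyl (I N i)) ↔ ∀ a ∈ I N i, gsat M (toGFP N φ i) I (overwrite s a)

lemma Correct.gsat_gfpAnd {N i : ℕ} {φ : IncForm L} (h : Correct M N φ i) (χ : GFPForm L)
    (I : RelInterp M) (s : ℕ → M) :
    gsat M (gfpAnd N i χ (toGFP N φ i)) I s ↔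
      ∃ Q : Set (Fin N → M), restr N s ∈ Q ∧
        (∀ a ∈ Q, gsat M χ (updI I N i Q) (overwrite s a)) ∧ teamSat M φ (cyl Q) := by
  have key (Q : Set (Fin N → M)) := h (updI I N i Q) s
  simp only [updI_same] at key
  simp only [key]
  constructor
  · rintro ⟨Q, hQ, hs⟩
    exact ⟨Q, hs, fun a ha => (hQ ha).1, fun a ha => (hQ ha).2⟩
  · rintro ⟨Q, hs, h₁, h₂⟩
    exact ⟨Q, fun a ha => ⟨h₁ a ha, h₂ a ha⟩, hs⟩

lemma teamSat_cyl_teamRel {N : ℕ} {φ : IncForm L} (hfv : fvInc φ ⊆ {v | v < N})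
    {X : Set (ℕ → M)} (h : teamSat M φ X) : teamSat M φ (cyl (teamRel N X)) :=
  teamSat_of_agreeOn φ ((agreeOn_cyl_teamRel X).mono hfv) h

/-- For formulas that are evaluated assignment by assignment. -/
lemma forall_cyl_iff {N : ℕ} {P : Set (Fin N → M)} {p : (ℕ → M) → Prop}
    (hp : ∀ s t, EqOn s t {v | v < N} → p s → p t) (s : ℕ → M) :
    (∀ t ∈ cyl P, p t) ↔ ∀ a ∈ P, p (overwrite s a) := by
  constructor
  · intro h a ha
    exact h _ (by simpa [cyl] using ha)
  · intro h t ht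
    exact hp _ _ (eqOn_of_restr_eq (restr_overwrite s _)) (h _ ht)

lemma correct_incl {N k : ℕ} (ts us : Fin k → L.Term ℕ)
    (hfv : fvInc (.incl ts us) ⊆ {v | v < N}) (i : ℕ) : Correct M N (.incl ts us) i := by
  have ht (j) : tvars (ts j) ⊆ {v | v < N} := fun v hv => hfv (Or.inl (mem_iUnion.2 ⟨j, hv⟩))
  have hu (j) : tvars (us j) ⊆ {v | v < N} := fun v hv => hfv (Or.inr (mem_iUnion.2 ⟨j, hv⟩))
  intro I s
  have key (u : ℕ → M) : gsat M (toGFP N (.incl ts us) i) I u ↔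
      ∃ s' ∈ cyl (I N i), ∀ j, (ts j).realize u = (us j).realize s' := by
    simp only [toGFP, gsat_exBlock, gsat_foldr_and, List.forall_mem_ofFn_iff, gsat,
      Term.realize_relabel, Term.realize_var]
    constructor
    · rintro ⟨t, e, h, hR⟩
      refine ⟨t ∘ (N + ·), hR, fun j => ?_⟩
      rw [← h j]
      exact realize_congr_tvars _ fun v hv => (e v (by have : v < N := ht j hv; omega)).symm
    · rintro ⟨s', hs', h⟩
      refine ⟨fun v => if N ≤ v ∧ v < N + N then s' (v - N) else u v,
        fun v hv => if_neg hv, fun j => ?_, ?_⟩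
      · refine Eq.trans ?_ ((h j).trans ?_)
        · exact realize_congr_tvars _ fun v hv =>
            if_neg (by have : v < N := ht j hv; omega)
        · refine realize_congr_tvars _ fun v hv => ?_
          have : v < N := hu j hv
          simp [this]
      · have e : (fun j : Fin N => if N ≤ N + (j : ℕ) ∧ N + (j : ℕ) < N + N
            then s' (N + j - N) else u (N + j)) = restr N s' := by
          funext j
          simp [restr]
        exact Eq.subst (motive := (· ∈ I N i)) e.symm hs'
  simp only [key]
  refine forall_cyl_iff (p := fun t => ∃ s' ∈ cyl (I N i), ∀ j, (ts j).realize t =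
    (us j).realize s') ?_ s
  rintro t t' e ⟨s', hs', h⟩
  refine ⟨s', hs', fun j => ?_⟩
  rw [← realize_congr_tvars _ (e.mono (ht j)), h j]

lemma correct_or {N i : ℕ} {φ ψ : IncForm L} (hφ : fvInc φ ⊆ {v | v < N})
    (hψ : fvInc ψ ⊆ {v | v < N}) (ihφ : Correct M N φ (i + 1)) (ihψ : Correct M N ψ (i + 1)) :
    Correct M N (.or φ ψ) i := by
  intro I s
  simp only [toGFP, gsat, ihφ.gsat_gfpAnd, ihψ.gsat_gfpAnd, realize_varTuple, restr_overwrite,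
    updI_of_ne _ _ _ _ (Nat.succ_ne_self i).symm]
  constructor
  · rintro ⟨Y, Z, e, hY, hZ⟩ a ha
    have ha' : overwrite s a ∈ cyl (I N i) := by simpa [cyl] using ha
    have sub (W) (hW : W ⊆ Y ∪ Z) : ∀ b ∈ teamRel N W, b ∈ I N i := by
      rintro _ ⟨t, htW, rfl⟩
      exact (e ▸ hW htW : t ∈ cyl (I N i))
    rw [e] at ha'
    rcases ha' with h | h
    · exact Or.inl ⟨teamRel N Y, ⟨_, h, (restr_overwrite s a).symm⟩, sub Y subset_union_left,
        teamSat_cyl_teamRel hφ hY⟩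
    · exact Or.inr ⟨teamRel N Z, ⟨_, h, (restr_overwrite s a).symm⟩, sub Z subset_union_right,
        teamSat_cyl_teamRel hψ hZ⟩
  · intro h
    refine ⟨⋃₀ {Y | teamSat M φ Y ∧ Y ⊆ cyl (I N i)}, ⋃₀ {Z | teamSat M ψ Z ∧ Z ⊆ cyl (I N i)},
      ?_, teamSat_sUnion φ fun Y hY => hY.1, teamSat_sUnion ψ fun Z hZ => hZ.1⟩
    ext t
    constructor
    · intro ht
      rcases h _ ht with ⟨Q, hQ, hQI, hs⟩ | ⟨Q, hQ, hQI, hs⟩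
      · exact Or.inl ⟨cyl Q, ⟨hs, fun u hu => hQI _ hu⟩, hQ⟩
      · exact Or.inr ⟨cyl Q, ⟨hs, fun u hu => hQI _ hu⟩, hQ⟩
    · rintro (⟨Y, ⟨-, hY⟩, hs⟩ | ⟨Y, ⟨-, hY⟩, hs⟩) <;> exact hY hs

lemma correct_ex {N i v : ℕ} {φ : IncForm L} (hφ : fvInc φ ⊆ {w | w < N})
    (ih : Correct M N φ (i + 1)) : Correct M N (.ex v φ) i := by
  intro I s
  simp only [toGFP, gsat, ih.gsat_gfpAnd, realize_varTuple,
    updI_of_ne _ _ _ _ (Nat.succ_ne_self i).symm]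
  constructor
  · rintro ⟨H, hH, h⟩ a ha
    have ha' : overwrite s a ∈ cyl (I N i) := by simpa [cyl] using ha
    obtain ⟨m, hm⟩ := hH _ ha'
    refine ⟨m, teamRel N (suppTeam (cyl (I N i)) H v), ⟨_, ⟨_, ha', m, hm, rfl⟩, rfl⟩, ?_,
      teamSat_cyl_teamRel hφ h⟩
    rintro b ⟨_, ⟨t, ht, m', -, rfl⟩, hb⟩
    obtain rfl : b = restr N (Function.update t v m') := hb
    refine ⟨t v, ?_⟩
    rw [restr_update_congr (restr_overwrite _ _) (t := Function.update t v m')]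
    simpa [cyl] using ht
  · intro h
    let 𝒬 : Set (Set (ℕ → M)) := {Y | ∃ Q : Set (Fin N → M), Y = cyl Q ∧ teamSat M φ (cyl Q) ∧
      ∀ t ∈ cyl Q, ∃ m, Function.update t v m ∈ cyl (I N i)}
    have e : suppTeam (cyl (I N i)) (fun t => {m | Function.update t v m ∈ ⋃₀ 𝒬}) v = ⋃₀ 𝒬 := by
      ext t
      constructor
      · rintro ⟨t, -, m, hm, rfl⟩
        exact hm
      · intro ht
        obtain ⟨_, ⟨Q, rfl, -, hQ⟩, htQ⟩ := id ht
        obtain ⟨m, hm⟩ := hQ t htQ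
        exact ⟨_, hm, t v, by simpa using ht, by simp⟩
    refine ⟨fun t => {m | Function.update t v m ∈ ⋃₀ 𝒬}, fun t ht => ?_, ?_⟩
    · obtain ⟨m, Q, hQ, hQI, hs⟩ := h _ ht
      refine ⟨m, cyl Q, ⟨Q, rfl, hs, fun u hu => ?_⟩, ?_⟩
      · obtain ⟨m', hm'⟩ := hQI _ hu
        rw [restr_update_congr (restr_overwrite _ _) (t := u)] at hm'
        exact ⟨m', hm'⟩
      · rw [restr_update_congr (restr_overwrite _ _) (t := t)] at hQ
        exact hQ
    · rw [e]
      refine teamSat_sUnion φ ?_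
      rintro _ ⟨Q, rfl, hs, -⟩
      exact hs

lemma correct_all {N i v : ℕ} {φ : IncForm L} (hφ : fvInc φ ⊆ {w | w < N})
    (ih : Correct M N φ (i + 1)) : Correct M N (.all v φ) i := by
  intro I s
  simp only [toGFP, gsat, ih.gsat_gfpAnd, realize_varTuple,
    updI_of_ne _ _ _ _ (Nat.succ_ne_self i).symm]
  constructor
  · intro h a ha m
    have ha' : overwrite s a ∈ cyl (I N i) := by simpa [cyl] using ha
    refine ⟨teamRel N (dupTeam M (cyl (I N i)) v), ⟨_, ⟨_, ha', m, rfl⟩, rfl⟩, ?_,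
      teamSat_cyl_teamRel hφ h⟩
    rintro b ⟨_, ⟨t, ht, m', rfl⟩, hb⟩
    obtain rfl : b = restr N (Function.update t v m') := hb
    refine ⟨t v, ?_⟩
    rw [restr_update_congr (restr_overwrite _ _) (t := Function.update t v m')]
    simpa [cyl] using ht
  · intro h
    let 𝒬 : Set (Set (ℕ → M)) := {Y | ∃ Q : Set (Fin N → M), Y = cyl Q ∧ teamSat M φ (cyl Q) ∧
      ∀ t ∈ cyl Q, ∃ m, Function.update t v m ∈ cyl (I N i)}
    have e : dupTeam M (cyl (I N i)) v = ⋃₀ 𝒬 := by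
      ext t
      constructor
      · rintro ⟨t, ht, m, rfl⟩
        obtain ⟨Q, hQ, hQI, hs⟩ := h _ ht m
        refine ⟨cyl Q, ⟨Q, rfl, hs, fun u hu => ?_⟩, ?_⟩
        · obtain ⟨m', hm'⟩ := hQI _ hu
          rw [restr_update_congr (restr_overwrite _ _) (t := u)] at hm'
          exact ⟨m', hm'⟩
        · rw [restr_update_congr (restr_overwrite _ _) (t := t)] at hQ
          exact hQ
      · rintro ⟨_, ⟨Q, rfl, -, hQ⟩, htQ⟩
        obtain ⟨m, hm⟩ := hQ t htQ
        exact ⟨_, hm, t v, by simp⟩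
    change teamSat M φ (dupTeam M (cyl (I N i)) v)
    rw [e]
    refine teamSat_sUnion φ ?_
    rintro _ ⟨Q, rfl, hs, -⟩
    exact hs

lemma correct_toGFP {N : ℕ} (φ : IncForm L) (hfv : fvInc φ ⊆ {v | v < N})
    (hb : boundVarBound φ ≤ N) (i : ℕ) : Correct M N φ i := by
  have loc {n : ℕ} {ts : Fin n → L.Term ℕ} (h : ⋃ i, tvars (ts i) ⊆ {v | v < N}) {s t : ℕ → M}
      (e : EqOn s t {v | v < N}) : (fun i => (ts i).realize s) = fun i => (ts i).realize t :=
    funext fun i => realize_congr_tvars _ (e.mono ((subset_iUnion _ i).trans h))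
  induction φ generalizing i with
  | rel R ts =>
    exact fun I s => forall_cyl_iff (p := fun t => Structure.RelMap R fun i => (ts i).realize t)
      (fun t t' e h => by rwa [← loc hfv e]) s
  | nrel R ts =>
    exact fun I s => forall_cyl_iff (p := fun t => ¬ Structure.RelMap R fun i => (ts i).realize t)
      (fun t t' e h => by rwa [← loc hfv e]) s
  | eq t u =>
    exact fun I s => forall_cyl_iff (p := fun s => t.realize s = u.realize s)
      (fun s s' e h => by
        rwa [← realize_congr_tvars t (e.mono (subset_union_left.trans hfv)),
          ← realize_congr_tvars u (e.mono (subset_union_right.trans hfv))]) s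
  | neq t u =>
    exact fun I s => forall_cyl_iff (p := fun s => t.realize s ≠ u.realize s)
      (fun s s' e h => by
        rwa [← realize_congr_tvars t (e.mono (subset_union_left.trans hfv)),
          ← realize_congr_tvars u (e.mono (subset_union_right.trans hfv))]) s
  | incl ts us => exact correct_incl ts us hfv i
  | and φ ψ ihφ ihψ =>
    intro I s
    simp only [teamSat, toGFP, gsat, forall_and,
      ihφ (subset_union_left.trans hfv) (le_of_max_le_left hb) i I s,
      ihψ (subset_union_right.trans hfv) (le_of_max_le_right hb) i I s]
  | or φ ψ ihφ ihψ =>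
    exact correct_or (subset_union_left.trans hfv) (subset_union_right.trans hfv)
      (ihφ (subset_union_left.trans hfv) (le_of_max_le_left hb) _)
      (ihψ (subset_union_right.trans hfv) (le_of_max_le_right hb) _)
  | ex v φ ih =>
    have hφ := fvInc_subset_of_diff hfv (le_of_max_le_left hb)
    exact correct_ex hφ (ih hφ (le_of_max_le_right hb) _)
  | all v φ ih =>
    have hφ := fvInc_subset_of_diff hfv (le_of_max_le_left hb)
    exact correct_all hφ (ih hφ (le_of_max_le_right hb) _)

end Translation

end TeamSem

open TeamSem in
/-- Theorem `inc-gfp`: for every inclusion logic formula `φ(x̄)` with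
free variables among `x̄ = (x₁,…,xₙ)` (here the variables `0,…,n-1`) there is a PGFP
formula `φ*(R, x̄)` (with `R` the relation variable number `0` of arity `n`, occurring
only positively — automatic in the syntax `GFPForm`) such that for all structures `M`
and teams `X` with domain `{x₁,…,xₙ}`:
`M ⊨_X φ(x̄)` iff `(M, X(x̄)) ⊨_s φ*(R, x̄)` for all `s ∈ X`. -/
theorem inc_to_gfp {L : Language} (n : ℕ) (φ : IncForm L)
    (hfv : fvInc φ ⊆ {v : ℕ | v < n}) :
    ∃ φstar : GFPForm L, fvG φstar ⊆ {v : ℕ | v < n} ∧ rvG φstar ⊆ {(0, n)} ∧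
      ∀ (M : Type*) [L.Structure M] (X : Set (ℕ → M)),
        teamSat M φ X ↔ ∀ s ∈ X, gsat M φstar (updI (botI M) n 0 (teamRel n X)) s := by
  obtain ⟨k, hk⟩ : ∃ k, boundVarBound φ ≤ n + k := ⟨boundVarBound φ, by omega⟩
  have hN : {v : ℕ | v < n} ⊆ {v | v < n + k} := fun v (hv : v < n) => by
    simp only [mem_ofPred_eq]; omega
  refine ⟨exBlock n k (gfpAnd (n + k) 1 (.rvar 0 (varTuple L n)) (toGFP (n + k) φ 1)), ?_, ?_, ?_⟩
  · rw [fvG_exBlock]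
    rintro v ⟨hv, hv'⟩
    have : v < n + k := fvG_gfpAnd_subset (χ := .rvar 0 (varTuple L n)) ((tvars_varTuple_subset n).trans hN)
      (fvG_toGFP_subset φ (hfv.trans hN) hk 1) hv
    simp only [mem_ofPred_eq] at hv' ⊢
    omega
  · rw [rvG_exBlock]
    exact rvG_gfpAnd_subset subset_rfl (rvG_toGFP_subset _ φ 1)
  · intro M _ X
    simp only [gsat_exBlock, (correct_toGFP φ (hfv.trans hN) hk 1).gsat_gfpAnd, gsat,
      realize_varTuple, updI_of_ne _ _ _ _ Nat.zero_ne_one, updI_same]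
    have eqn {s t : ℕ → M} (h : restr (n + k) s = restr (n + k) t) : restr n s = restr n t :=
      funext fun j => eqOn_of_restr_eq h (hN j.2)
    constructor
    · intro h s hs
      refine ⟨s, fun _ _ => rfl, teamRel (n + k) X, ⟨s, hs, rfl⟩, ?_,
        teamSat_cyl_teamRel (hfv.trans hN) h⟩
      rintro _ ⟨t, ht, rfl⟩
      exact ⟨t, ht, eqn (restr_overwrite s (restr (n + k) t))⟩
    · intro h
      refine teamSat_of_agreeOn φ (X := ⋃₀ {Y | teamSat M φ Y ∧ ∀ t ∈ Y, restr n t ∈ teamRel n X})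
        (AgreeOn.mono ⟨?_, ?_⟩ hfv) (teamSat_sUnion φ fun Y hY => hY.1)
      · rintro t ⟨Y, ⟨-, hY⟩, ht⟩
        obtain ⟨s, hs, e⟩ := hY t ht
        exact ⟨s, hs, eqOn_of_restr_eq (N := n) e⟩
      · intro s hs
        obtain ⟨t, e, Q, htQ, hQ, hφ⟩ := h s hs
        refine ⟨t, ⟨cyl Q, ⟨hφ, fun u hu => ?_⟩, htQ⟩, fun v (hv : v < n) => e v (by omega)⟩
        rw [← eqn (restr_overwrite t (restr (n + k) u))]
        exact hQ _ hu
end
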